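/- (S1+SP is a proper sublogic of S3) The formula □(x₀→x₁)→□(□x₀→□x₁) (an instance of the S3 axiom scheme (3)) is a theorem of the Lewis system S3 but is not a theorem of S1+SP. -/

import Mathlib

/-- Modal formulas over countably many propositional variables x₀, x₁, …. -/
inductive Fm : Type
  | var : ℕ → Fm
  | neg : Fm → Fm
  | imp : Fm → Fm → Fm
  | box : Fm → Fm
deriving DecidableEq

namespace Fm

/-- ⊤ := x₀ → x₀ -/
def top : Fm := imp (var 0) (var 0)

/-- φ ∧ ψ := ¬(φ → ¬ψ) -/
def conj (φ ψ : Fm) : Fm := neg (imp φ (neg ψ))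

/-- φ ↔ ψ := (φ → ψ) ∧ (ψ → φ) -/
def biimp (φ ψ : Fm) : Fm := conj (imp φ ψ) (imp ψ φ)

/-- strict equivalence: φ ≡ ψ := □(φ → ψ) ∧ □(ψ → φ) -/
def equiv (φ ψ : Fm) : Fm := conj (box (imp φ ψ)) (box (imp ψ φ))

/-- φ[x := ψ]: substitution of ψ for all occurrences of the variable x in φ. -/
def subst (φ : Fm) (x : ℕ) (ψ : Fm) : Fm :=
  match φ with
  | var y => if y = x then ψ else var y
  | neg χ => neg (subst χ x ψ)
  | imp χ δ => imp (subst χ x ψ) (subst δ x ψ)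
  | box χ => box (subst χ x ψ)

/-- Propositional (two-valued) evaluation of a modal formula, treating
variables and boxed formulas as atoms. -/
def pEval (v : Fm → Bool) : Fm → Bool
  | var n => v (var n)
  | neg φ => !(pEval v φ)
  | imp φ ψ => !(pEval v φ) || pEval v ψ
  | box φ => v (box φ)

/-- φ has the form of a propositional tautology, i.e. φ is a substitution
instance of a propositional tautology. -/
def isTautInstance (φ : Fm) : Prop := ∀ v : Fm → Bool, pEval v φ = true

/-- The axioms (i)–(iii) of Lewis system S1 (Lemmon-style). -/
inductive S1Axiom : Fm → Prop
  | taut {φ} : isTautInstance φ → S1Axiom φ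
  | ax2 (φ) : S1Axiom (imp (box φ) φ)
  | ax3 (φ ψ χ) :
      S1Axiom (imp (conj (box (imp φ ψ)) (box (imp ψ χ))) (box (imp φ χ)))

/-- The identity axioms (iv)–(vi), i.e. the Substitution Principle SP. -/
inductive SPAxiom : Fm → Prop
  | ax4 (φ ψ) : SPAxiom (imp (equiv φ ψ) (equiv (neg φ) (neg ψ)))
  | ax5 (φ ψ φ' ψ') :
      SPAxiom (imp (conj (equiv φ ψ) (equiv φ' ψ'))
        (equiv (imp φ φ') (imp ψ ψ')))
  | ax6 (φ ψ) : SPAxiom (imp (equiv φ ψ) (equiv (box φ) (box ψ)))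

/-- Derivability in S1+SP from a set Φ of premises: axioms (i)–(vi),
modus ponens, and Axiom Necessitation AN restricted to axioms (i)–(iii). -/
inductive S1SP : Set Fm → Fm → Prop
  | prem {Φ φ} : φ ∈ Φ → S1SP Φ φ
  | axm {Φ φ} : S1Axiom φ → S1SP Φ φ
  | spAxm {Φ φ} : SPAxiom φ → S1SP Φ φ
  | mp {Φ φ ψ} : S1SP Φ (imp φ ψ) → S1SP Φ φ → S1SP Φ ψ
  | an {Φ φ} : S1Axiom φ → S1SP Φ (box φ)

end Fm

namespace Fm

/-- The axioms of Lewis system S3: the S1 axioms (i)–(iii) together with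
the scheme (3) □(φ→ψ) → □(□φ→□ψ). -/
inductive S3Axiom : Fm → Prop
  | s1 {φ} : S1Axiom φ → S3Axiom φ
  | ax3 (φ ψ) : S3Axiom (imp (box (imp φ ψ)) (box (imp (box φ) (box ψ))))

/-- Derivability in Lewis system S3 from a set Φ of premises: axioms
(i)–(iii),(3), modus ponens, Axiom Necessitation AN applicable to all axioms,
and Substitution of Proved Strict Equivalents SPSE. -/
inductive S3 : Set Fm → Fm → Prop
  | prem {Φ φ} : φ ∈ Φ → S3 Φ φ
  | axm {Φ φ} : S3Axiom φ → S3 Φ φ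
  | mp {Φ φ ψ} : S3 Φ (imp φ ψ) → S3 Φ φ → S3 Φ ψ
  | an {Φ φ} : S3Axiom φ → S3 Φ (box φ)
  | spse {Φ} (φ : Fm) (x : ℕ) {ψ ψ'} : S3 ∅ (equiv ψ ψ') →
      S3 Φ (equiv (subst φ x ψ) (subst φ x ψ'))

end Fm

namespace Fm

/-- The value of a formula in the four-element countermodel. -/
def mval : Fm → Bool × Bool
  | var n => if n = 0 then (false, true) else (true, true)
  | neg φ => (!(mval φ).1, !(mval φ).2)
  | imp φ ψ => (!(mval φ).1 || (mval ψ).1, !(mval φ).2 || (mval ψ).2)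
  | box φ => ((mval φ).1 && (mval φ).2, !(mval φ).1 && (mval φ).2)

theorem mval_fst (φ : Fm) : pEval (fun χ => (mval χ).1) φ = (mval φ).1 := by
  induction φ <;> simp_all [pEval, mval]

theorem mval_snd (φ : Fm) : pEval (fun χ => (mval χ).2) φ = (mval φ).2 := by
  induction φ <;> simp_all [pEval, mval]

theorem mval_s1 {φ : Fm} (h : S1Axiom φ) : (mval φ).1 = true ∧ (mval φ).2 = true := by
  cases h with
  | taut h => exact ⟨by rw [← mval_fst]; exact h _, by rw [← mval_snd]; exact h _⟩
  | ax2 φ =>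
    simp only [mval]
    generalize mval φ = a
    revert a; decide
  | ax3 φ ψ χ =>
    simp only [mval, conj]
    generalize mval φ = a
    generalize mval ψ = b
    generalize mval χ = c
    revert a b c; decide

theorem mval_sp {φ : Fm} (h : SPAxiom φ) : (mval φ).1 = true := by
  cases h with
  | ax4 φ ψ =>
    simp only [mval, conj, equiv]
    generalize mval φ = a
    generalize mval ψ = b
    revert a b; decide
  | ax5 φ ψ φ' ψ' =>
    simp only [mval, conj, equiv]
    generalize mval φ = a
    generalize mval ψ = b
    generalize mval φ' = c
    generalize mval ψ' = d
    revert a b c d; decide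
  | ax6 φ ψ =>
    simp only [mval, conj, equiv]
    generalize mval φ = a
    generalize mval ψ = b
    revert a b; decide

theorem mval_sound {Φ : Set Fm} {φ : Fm} (h : S1SP Φ φ) (hΦ : Φ = ∅) :
    (mval φ).1 = true := by
  induction h with
  | prem h => subst hΦ; exact absurd h (Set.notMem_empty _)
  | axm h => exact (mval_s1 h).1
  | spAxm h => exact mval_sp h
  | mp _ _ ih1 ih2 =>
    have h1 := ih1
    have h2 := ih2
    simpa [mval, h2] using h1
  | an h => simp [mval, mval_s1 h]

end Fm

open Fm in
/-- S1+SP is a proper sublogic of S3: the instance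
□(x₀→x₁) → □(□x₀→□x₁) of scheme (3) is a theorem of S3 but not of S1+SP. -/
theorem S1SP_proper_sublogic_of_S3 :
    S3 ∅ (imp (box (imp (var 0) (var 1)))
      (box (imp (box (var 0)) (box (var 1))))) ∧
    ¬ S1SP ∅ (imp (box (imp (var 0) (var 1)))
      (box (imp (box (var 0)) (box (var 1))))) := by
  refine ⟨S3.axm (S3Axiom.ax3 _ _), fun h => ?_⟩
  have := mval_sound h rfl
  revert this
  decide
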